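/- Uniform positivity behind a spreading front (Lemma 4.2, nonlocal dispersal case). Assume f satisfies (H0) and (H1) holds with limit nonlinearity f₀. Let ξ ∈ ℝ^N be a unit vector, δ₀ > 0, n* ∈ ℕ, and let ψ : ℝ → ℝ be continuous and nonincreasing with 0 ≤ ψ ≤ δ₀, liminf_{r→−∞} ψ(r) > 0 and ψ(r) = 0 for r ≥ 0; set v₀(x) = ψ(x·ξ + n*). Let u be a solution of (E_f) on [0,∞) with u(0,·) = v₀, and suppose there exist K ∈ ℕ with K ≥ 1 and c' > 0 such that: (i) u(t + KT, x) ≥ δ₀ for all t ∈ [0,KT] and all x with x·ξ ≤ c'(t + KT) − n*; (ii) u(t + KT, x) ≥ v₀(x) for all t ∈ [0,KT] and all x. Then for every M > 0 there exists δ̃ > 0 such that u(t,x) ≥ δ̃ for all t ≥ KT and all x with x·ξ ≤ M. -/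

import Mathlib

open MeasureTheory Set Filter RealInnerProductSpace

noncomputable section

abbrev Euc (N : ℕ) := EuclideanSpace ℝ (Fin N)

/-- Membership in `X`: bounded and uniformly continuous real functions on `ℝ^N`. -/
def MemX {N : ℕ} (u : Euc N → ℝ) : Prop :=
  UniformContinuous u ∧ ∃ C, ∀ x, |u x| ≤ C

/-- Hypotheses on the convolution kernel `κ`. -/
def KernelHyp {N : ℕ} (κ : Euc N → ℝ) : Prop :=
  Continuous κ ∧ (∀ z, 0 ≤ κ z) ∧ HasCompactSupport κ ∧ 0 < κ 0 ∧ (∫ z, κ z) = 1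

/-- Hypothesis (H0) on the nonlinearity `f`. -/
def SatH0 {N : ℕ} (T M₀ : ℝ) (f : ℝ → Euc N → ℝ → ℝ) : Prop :=
  (∀ t x u, f (t + T) x u = f t x u) ∧
  (∀ x : Euc N, ContDiff ℝ 1 (fun p : ℝ × ℝ => f p.1 x p.2)) ∧
  (∀ R : ℝ, 0 < R →
    (∃ C, ∀ t x u, |u| ≤ R →
      |f t x u| + |deriv (fun s => f s x u) t| + |deriv (fun v => f t x v) u| ≤ C) ∧
    UniformContinuousOn (fun p : ℝ × Euc N × ℝ => f p.1 p.2.1 p.2.2)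
      {p : ℝ × Euc N × ℝ | |p.2.2| ≤ R} ∧
    UniformContinuousOn (fun p : ℝ × Euc N × ℝ => deriv (fun s => f s p.2.1 p.2.2) p.1)
      {p : ℝ × Euc N × ℝ | |p.2.2| ≤ R} ∧
    UniformContinuousOn (fun p : ℝ × Euc N × ℝ => deriv (fun v => f p.1 p.2.1 v) p.2.2)
      {p : ℝ × Euc N × ℝ | |p.2.2| ≤ R}) ∧
  (∀ t x u, M₀ ≤ u → f t x u < 0) ∧
  (∀ a b : ℝ, 0 ≤ a → a ≤ b → ∃ c < (0:ℝ), ∀ t x u, a ≤ u → u ≤ b →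
    deriv (fun v => f t x v) u ≤ c)

/-- Right-hand side of the nonlocal dispersal KPP equation (E_g). -/
def RHS {N : ℕ} (κ : Euc N → ℝ) (g : ℝ → Euc N → ℝ → ℝ)
    (u : ℝ → Euc N → ℝ) (t : ℝ) (x : Euc N) : ℝ :=
  (∫ y, κ (y - x) * u t y) - u t x + u t x * g t x (u t x)

/-- A solution of (E_g) on the interval `I`. -/
def IsSol {N : ℕ} (κ : Euc N → ℝ) (g : ℝ → Euc N → ℝ → ℝ)
    (u : ℝ → Euc N → ℝ) (I : Set ℝ) : Prop :=
  ContinuousOn (fun p : ℝ × Euc N => u p.1 p.2) (I ×ˢ univ) ∧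
  (∀ t ∈ I, MemX (u t)) ∧
  (∀ J : Set ℝ, J ⊆ I → IsCompact J → ∃ C, ∀ t ∈ J, ∀ x, |u t x| ≤ C) ∧
  (∀ x : Euc N, ∀ t ∈ interior I, HasDerivAt (fun s => u s x) (RHS κ g u t x) t)

/-- A time periodic strictly positive solution of (E_g). -/
def PeriodicPosSol {N : ℕ} (κ : Euc N → ℝ) (g : ℝ → Euc N → ℝ → ℝ) (T : ℝ)
    (u : ℝ → Euc N → ℝ) : Prop :=
  IsSol κ g u univ ∧ (∀ t x, u (t + T) x = u t x) ∧ ∃ δ > 0, ∀ t x, δ ≤ u t x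

/-- The part metric between two strictly positive bounded functions. -/
def PartMetric {N : ℕ} (u v : Euc N → ℝ) : ℝ :=
  sInf (Real.log '' {α : ℝ | 1 ≤ α ∧ ∀ x, u x / α ≤ v x ∧ v x ≤ α * u x})

/-- Hypothesis (H1): `f` is asymptotically (in space) equal to the time and space
periodic nonlinearity `f₀`. -/
def SatH1 {N : ℕ} (T M₀ : ℝ) (p : Fin N → ℝ) (f f₀ : ℝ → Euc N → ℝ → ℝ) : Prop :=
  SatH0 T M₀ f₀ ∧ (∀ i, 0 < p i) ∧
  (∀ i t x u, f₀ t (x + p i • EuclideanSpace.single i (1:ℝ)) u = f₀ t x u) ∧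
  (∀ R : ℝ, 0 < R → ∀ ε : ℝ, 0 < ε → ∃ ρ : ℝ, ∀ t x u, ρ ≤ ‖x‖ → |u| ≤ R →
    |f t x u - f₀ t x u| ≤ ε)

/-- A time and space periodic positive solution of (E_g) (period `T` in time and
periods `pᵢ` in the spatial coordinate directions). -/
def PeriodicMediaSol {N : ℕ} (κ : Euc N → ℝ) (g : ℝ → Euc N → ℝ → ℝ) (T : ℝ)
    (p : Fin N → ℝ) (u : ℝ → Euc N → ℝ) : Prop :=
  IsSol κ g u univ ∧ (∀ t x, u (t + T) x = u t x) ∧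
  (∀ i t x, u t (x + p i • EuclideanSpace.single i (1:ℝ)) = u t x) ∧
  (∀ t x, 0 < u t x)

/-- The class `X⁺(ξ)` of front-like nonnegative initial data in the direction `ξ`. -/
def XplusXi {N : ℕ} (ξ : Euc N) (u : Euc N → ℝ) : Prop :=
  MemX u ∧ (∀ x, 0 ≤ u x) ∧
  (∃ m > 0, ∃ r : ℝ, ∀ x, ⟪x, ξ⟫ ≤ r → m ≤ u x) ∧
  (∃ r₀ : ℝ, ∀ x, r₀ ≤ ⟪x, ξ⟫ → u x = 0)


theorem kerInt {N : ℕ} {κ : Euc N → ℝ} (hκ : KernelHyp κ) (v : Euc N → ℝ) (hv : Continuous v)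
    (x : Euc N) : Integrable (fun y => κ (y - x) * v y) := by
  obtain ⟨hc, -, hs, -, -⟩ := hκ
  apply Continuous.integrable_of_hasCompactSupport
  · fun_prop
  · apply HasCompactSupport.mul_right
    exact hs.comp_homeomorph (Homeomorph.subRight x)

theorem kerOne {N : ℕ} {κ : Euc N → ℝ} (hκ : KernelHyp κ) (x : Euc N) :
    (∫ y, κ (y - x)) = 1 := by
  rw [integral_sub_right_eq_self κ x]; exact hκ.2.2.2.2

theorem maxStep {N : ℕ} {κ : Euc N → ℝ} (hκ : KernelHyp κ) (w : ℝ → Euc N → ℝ) (S L : ℝ)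
    (hL : 0 ≤ L)
    (hc : ∀ x, ContinuousOn (fun s => w s x) (Icc 0 S))
    (hcx : ∀ t ∈ Icc 0 S, Continuous (w t))
    (h0 : ∀ x, 0 ≤ w 0 x)
    (hd : ∀ t ∈ Ioo 0 S, ∀ x, ∃ d, HasDerivAt (fun s => w s x) d t ∧
      (∫ y, κ (y - x) * w t y) - L * |w t x| ≤ d)
    (q : ℝ) (hq : 0 < q)
    (hlow : ∀ t ∈ Icc 0 S, ∀ x, -(q * Real.exp ((L + 3) * t)) ≤ w t x) :
    ∀ t ∈ Icc 0 S, ∀ x, -(q / 2 * Real.exp ((L + 3) * t)) ≤ w t x := by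
  intro t ht x
  rcases eq_or_lt_of_le ht.1 with h | htpos
  · subst h
    have := h0 x
    have := Real.exp_pos ((L + 3) * 0)
    nlinarith
  have hcont0 : ContinuousWithinAt (fun s => w s x) (Icc 0 t) 0 :=
    ((hc x).mono (Icc_subset_Icc_right ht.2)) 0 ⟨le_refl _, htpos.le⟩
  have hev : ∀ᶠ s in nhdsWithin 0 (Ioo 0 t), -(q/2) < w s x := by
    have h1 : ContinuousWithinAt (fun s => w s x) (Ioo 0 t) 0 := hcont0.mono Ioo_subset_Icc_self
    exact h1.eventually (lt_mem_nhds (by have := h0 x; linarith))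
  have hne : (nhdsWithin (0:ℝ) (Ioo 0 t)).NeBot := by
    rw [nhdsWithin_Ioo_eq_nhdsGT htpos]; infer_instance
  obtain ⟨ε, hε, hε0, hεt⟩ := (hev.and eventually_mem_nhdsWithin).exists
  choose! d hdd hdl using hd
  have hexp : ∀ s : ℝ, HasDerivAt (fun s => q / 2 * Real.exp ((L + 3) * s))
      (q / 2 * (Real.exp ((L + 3) * s) * (L + 3))) s := by
    intro s
    have h := ((hasDerivAt_id s).const_mul (L + 3)).exp.const_mul (q/2)
    simpa using h
  have hsub : ∀ s ∈ Ico ε t, s ∈ Ioo 0 S := fun s hs =>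
    ⟨hε0.trans_le hs.1, hs.2.trans_le ht.2⟩
  have key := image_le_of_deriv_right_lt_deriv_boundary' (f := fun s => -w s x)
    (f' := fun s => -d s x) (a := ε) (b := t)
    (B := fun s => q / 2 * Real.exp ((L + 3) * s))
    (B' := fun s => q / 2 * (Real.exp ((L + 3) * s) * (L + 3)))
    (((hc x).mono (Icc_subset_Icc hε0.le ht.2)).neg)
    (fun s hs => (hdd s (hsub s hs) x).neg.hasDerivWithinAt)
    (by
      have : 1 ≤ Real.exp ((L + 3) * ε) := Real.one_le_exp (by positivity)
      show -w ε x ≤ q / 2 * Real.exp ((L + 3) * ε)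
      nlinarith)
    (fun s _ => (hexp s).continuousAt.continuousWithinAt)
    (fun s _ => (hexp s).hasDerivWithinAt)
    (by
      intro s hs heq
      have hs' := hsub s hs
      have hsI : s ∈ Icc 0 S := Ioo_subset_Icc_self hs'
      have h1 := hdl s hs' x
      have h2 : -(q * Real.exp ((L + 3) * s)) ≤ ∫ y, κ (y - x) * w s y := by
        have hm : (∫ y, κ (y - x) * (-(q * Real.exp ((L + 3) * s)))) ≤
            ∫ y, κ (y - x) * w s y := by
          apply integral_mono (kerInt hκ (fun _ => _) continuous_const x)
            (kerInt hκ _ (hcx s hsI) x)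
          intro y
          exact mul_le_mul_of_nonneg_left (hlow s hsI y) (hκ.2.1 _)
        rw [integral_mul_const, kerOne hκ] at hm
        linarith
      have h3 : |w s x| = q / 2 * Real.exp ((L + 3) * s) := by
        have : w s x = -(q / 2 * Real.exp ((L + 3) * s)) := by
          linarith
        rw [this, abs_neg, abs_of_pos (by positivity)]
      rw [h3] at h1
      have : 0 < q * Real.exp ((L + 3) * s) := by positivity
      show -d s x < q / 2 * (Real.exp ((L + 3) * s) * (L + 3))
      nlinarith)
  have := key ⟨hεt.le, le_refl t⟩
  linarith

theorem maxPos {N : ℕ} {κ : Euc N → ℝ} (hκ : KernelHyp κ) (w : ℝ → Euc N → ℝ) (S L B : ℝ)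
    (hL : 0 ≤ L)
    (hB : ∀ t ∈ Icc 0 S, ∀ x, |w t x| ≤ B)
    (hc : ∀ x, ContinuousOn (fun s => w s x) (Icc 0 S))
    (hcx : ∀ t ∈ Icc 0 S, Continuous (w t))
    (h0 : ∀ x, 0 ≤ w 0 x)
    (hd : ∀ t ∈ Ioo 0 S, ∀ x, ∃ d, HasDerivAt (fun s => w s x) d t ∧
      (∫ y, κ (y - x) * w t y) - L * |w t x| ≤ d) :
    ∀ t ∈ Icc 0 S, ∀ x, 0 ≤ w t x := by
  have hn : ∀ n : ℕ, ∀ t ∈ Icc 0 S, ∀ x,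
      -(((|B| + 1) * (1/2:ℝ) ^ n) * Real.exp ((L + 3) * t)) ≤ w t x := by
    intro n
    induction n with
    | zero =>
      intro t ht x
      have h1 : 1 ≤ Real.exp ((L + 3) * t) := Real.one_le_exp (mul_nonneg (by linarith) ht.1)
      have h2 := (abs_le.1 (hB t ht x)).1
      have h3 := le_abs_self B
      have h4 := abs_nonneg B
      rw [pow_zero, mul_one]
      nlinarith
    | succ n ih =>
      have h := maxStep hκ w S L hL hc hcx h0 hd _ (by positivity) ih
      intro t ht x
      have := h t ht x
      rw [pow_succ]
      convert this using 3
      ring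
  intro t ht x
  have hlim : Tendsto (fun n : ℕ => -(((|B| + 1) * (1/2:ℝ) ^ n) * Real.exp ((L + 3) * t)))
      atTop (nhds (-(((|B| + 1) * 0) * Real.exp ((L + 3) * t)))) := by
    refine ((Tendsto.const_mul _ ?_).mul_const _).neg
    exact tendsto_pow_atTop_nhds_zero_of_lt_one (by norm_num) (by norm_num)
  have := le_of_tendsto' hlim (fun n => hn n t ht x)
  simpa using this

theorem lipF {N : ℕ} {T M₀ : ℝ} {f : ℝ → Euc N → ℝ → ℝ} (hf : SatH0 T M₀ f) (R : ℝ)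
    (hR : 0 < R) : ∃ L, 0 ≤ L ∧ ∀ t x a b, |a| ≤ R → |b| ≤ R →
      |(-a + a * f t x a) - (-b + b * f t x b)| ≤ L * |a - b| := by
  obtain ⟨-, hC1, hbd, -, -⟩ := hf
  obtain ⟨⟨C, hC⟩, -⟩ := hbd R hR
  have hC0 : 0 ≤ C := by
    have := hC 0 0 0 (by simpa using hR.le)
    have h1 := abs_nonneg (f 0 0 0)
    have h2 := abs_nonneg (deriv (fun s => f s 0 0) 0)
    have h3 := abs_nonneg (deriv (fun v => f 0 0 v) 0)
    linarith
  refine ⟨1 + C + R * C, by positivity, ?_⟩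
  intro t x a b ha hb
  have hdiff : Differentiable ℝ (fun v => f t x v) := by
    have : ContDiff ℝ 1 (fun v : ℝ => f t x v) :=
      (hC1 x).comp (contDiff_const.prodMk contDiff_id : ContDiff ℝ 1 (fun v : ℝ => (t, v)))
    exact this.differentiable (by norm_num)
  have hlip : |f t x a - f t x b| ≤ C * |a - b| := by
    have := Convex.norm_image_sub_le_of_norm_deriv_le (f := fun v => f t x v) (s := Icc (-R) R)
      (C := C) (x := b) (y := a) (fun v _ => hdiff v) (fun v hv => by
        have h := hC t x v (abs_le.2 hv)
        have h1 := abs_nonneg (f t x v)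
        have h2 := abs_nonneg (deriv (fun s => f s x v) t)
        rw [Real.norm_eq_abs]; linarith) (convex_Icc _ _) (abs_le.1 hb) (abs_le.1 ha)
    simpa using this
  have hfa : |f t x a| ≤ C := by
    have h := hC t x a ha
    have h2 := abs_nonneg (deriv (fun s => f s x a) t)
    have h3 := abs_nonneg (deriv (fun v => f t x v) a)
    linarith
  have e : (-a + a * f t x a) - (-b + b * f t x b)
      = -(a - b) + (a - b) * f t x a + b * (f t x a - f t x b) := by ring
  rw [e]
  have h1 : |(a - b) * f t x a| ≤ C * |a - b| := by
    rw [abs_mul, mul_comm]; exact mul_le_mul_of_nonneg_right hfa (abs_nonneg _)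
  have h2 : |b * (f t x a - f t x b)| ≤ R * (C * |a - b|) := by
    rw [abs_mul]; exact mul_le_mul hb hlip (abs_nonneg _) hR.le
  have h3 := abs_add_le (-(a - b) + (a - b) * f t x a) (b * (f t x a - f t x b))
  have h4 := abs_add_le (-(a - b)) ((a - b) * f t x a)
  rw [abs_neg] at h4
  linarith

theorem solBasic {N : ℕ} {κ : Euc N → ℝ} {f : ℝ → Euc N → ℝ → ℝ} {u : ℝ → Euc N → ℝ}
    (hu : IsSol κ f u (Ici 0)) :
    (∀ x, ContinuousOn (fun s => u s x) (Ici 0)) ∧ (∀ t, 0 ≤ t → Continuous (u t)) ∧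
    (∀ S, ∃ C, 0 < C ∧ ∀ t ∈ Icc 0 S, ∀ x, |u t x| ≤ C) ∧
    (∀ x t, 0 < t → HasDerivAt (fun s => u s x) (RHS κ f u t x) t) := by
  obtain ⟨h1, h2, h3, h4⟩ := hu
  refine ⟨fun x => ?_, fun t ht => (h2 t ht).1.continuous, fun S => ?_, fun x t ht => ?_⟩
  · exact h1.comp (f := fun s : ℝ => (s, x)) (by fun_prop) (fun s hs => ⟨hs, mem_univ _⟩)
  · obtain ⟨C, hC⟩ := h3 (Icc 0 S) Icc_subset_Ici_self isCompact_Icc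
    exact ⟨|C| + 1, by positivity, fun t ht x => by
      have := hC t ht x
      have := le_abs_self C
      linarith⟩
  · exact h4 x t (by rw [interior_Ici]; exact ht)

theorem compar {N : ℕ} {T M₀ : ℝ} {κ : Euc N → ℝ} (hκ : KernelHyp κ)
    {f : ℝ → Euc N → ℝ → ℝ} (hf : SatH0 T M₀ f) {u v : ℝ → Euc N → ℝ}
    (hu1 : ∀ x, ContinuousOn (fun s => u s x) (Ici 0)) (hu2 : ∀ t, 0 ≤ t → Continuous (u t))
    (hu3 : ∀ S, ∃ C, 0 < C ∧ ∀ t ∈ Icc 0 S, ∀ x, |u t x| ≤ C)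
    (hu4 : ∀ x t, 0 < t → HasDerivAt (fun s => u s x) (RHS κ f u t x) t)
    (hv1 : ∀ x, ContinuousOn (fun s => v s x) (Ici 0)) (hv2 : ∀ t, 0 ≤ t → Continuous (v t))
    (hv3 : ∀ S, ∃ C, 0 < C ∧ ∀ t ∈ Icc 0 S, ∀ x, |v t x| ≤ C)
    (hv4 : ∀ x t, 0 < t → HasDerivAt (fun s => v s x) (RHS κ f v t x) t)
    (h0 : ∀ x, u 0 x ≤ v 0 x) : ∀ t, 0 ≤ t → ∀ x, u t x ≤ v t x := by
  intro S hS x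
  obtain ⟨C, hC, hCu⟩ := hu3 S
  obtain ⟨D, hD, hDv⟩ := hv3 S
  obtain ⟨L, hL, hLip⟩ := lipF hf (C + D) (by positivity)
  have h := maxPos hκ (fun t x => v t x - u t x) S L (C + D) hL
    (fun t ht x => by
      have h1 := abs_sub (v t x) (u t x)
      have := hCu t ht x
      have := hDv t ht x
      linarith)
    (fun x => ((hv1 x).sub (hu1 x)).mono Icc_subset_Ici_self)
    (fun t ht => (hv2 t ht.1).sub (hu2 t ht.1))
    (fun x => sub_nonneg.2 (h0 x))
    (fun t ht x => ⟨_, (hv4 x t ht.1).sub (hu4 x t ht.1), by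
      have htI : t ∈ Icc 0 S := Ioo_subset_Icc_self ht
      have e : (∫ y, κ (y - x) * (v t y - u t y)) =
          (∫ y, κ (y - x) * v t y) - ∫ y, κ (y - x) * u t y := by
        rw [← integral_sub (kerInt hκ _ (hv2 t ht.1.le) x) (kerInt hκ _ (hu2 t ht.1.le) x)]
        congr 1; ext y; ring
      have hl := hLip t x (v t x) (u t x) ((hDv t htI x).trans (by linarith))
        ((hCu t htI x).trans (by linarith))
      have hl' := (abs_le.1 hl).1
      simp only [RHS]
      rw [e]
      linarith⟩)
  have := h S ⟨hS, le_refl _⟩ x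
  linarith

theorem kerLow {N : ℕ} {κ : Euc N → ℝ} (hκ : KernelHyp κ) (ξ : Euc N) (hξ : ‖ξ‖ = 1) :
    ∃ η > 0, ∃ θ > 0, ∀ (v : Euc N → ℝ) (a r : ℝ), Continuous v → (∀ y, 0 ≤ v y) → 0 < a →
      (∀ y, ⟪y, ξ⟫ ≤ r → a ≤ v y) → ∀ x, ⟪x, ξ⟫ ≤ r + η →
      a * θ ≤ ∫ y, κ (y - x) * v y := by
  have hc := hκ.1
  have hpos := hκ.2.2.2.1
  have hev : ∀ᶠ z in nhds (0 : Euc N), κ 0 / 2 < κ z :=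
    hc.continuousAt.eventually (lt_mem_nhds (by linarith))
  obtain ⟨ρ, hρ, hball⟩ := Metric.eventually_nhds_iff.1 hev
  refine ⟨ρ / 4, by positivity, κ 0 / 2 * volume.real (Metric.ball (0 : Euc N) (ρ / 4)), ?_, ?_⟩
  · have : 0 < volume.real (Metric.ball (0 : Euc N) (ρ / 4)) :=
      ENNReal.toReal_pos (Metric.measure_ball_pos volume _ (by positivity)).ne'
        measure_ball_lt_top.ne
    positivity
  intro v a r hv hv0 ha hav x hx
  set A := Metric.ball (x - (ρ / 2) • ξ) (ρ / 4) with hA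
  have h1 : (∫ y, A.indicator (fun _ => κ 0 / 2 * a) y) ≤ ∫ y, κ (y - x) * v y := by
    apply integral_mono
    · exact (integrable_indicator_iff measurableSet_ball).2
        (integrableOn_const measure_ball_lt_top.ne)
    · exact kerInt hκ v hv x
    intro y
    by_cases hy : y ∈ A
    · simp only [indicator_of_mem hy]
      rw [hA, Metric.mem_ball, dist_eq_norm] at hy
      have hk : κ 0 / 2 < κ (y - x) := by
        apply hball
        rw [dist_zero_right]
        have e : y - x = (y - (x - (ρ / 2) • ξ)) - (ρ / 2) • ξ := by abel
        rw [e]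
        refine (norm_sub_le _ _).trans_lt ?_
        rw [norm_smul, hξ, Real.norm_eq_abs, abs_of_pos (by positivity)]
        linarith
      have hin : ⟪y, ξ⟫ ≤ r := by
        have e : y = (y - (x - (ρ / 2) • ξ)) + (x - (ρ / 2) • ξ) := by abel
        have h2 : ⟪y - (x - (ρ / 2) • ξ), ξ⟫ ≤ ρ / 4 := by
          refine (real_inner_le_norm _ _).trans ?_
          rw [hξ, mul_one]; exact hy.le
        rw [e, inner_add_left, inner_sub_left x, real_inner_smul_left,
          real_inner_self_eq_norm_sq, hξ]
        linarith
      exact mul_le_mul hk.le (hav y hin) ha.le (hκ.2.1 _)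
    · simp only [indicator_of_notMem hy]
      exact mul_nonneg (hκ.2.1 _) (hv0 y)
  rw [integral_indicator measurableSet_ball, setIntegral_const,
    Measure.addHaar_real_ball_center, smul_eq_mul] at h1
  linarith

theorem growth (g : ℝ → ℝ) (S L b τ : ℝ) (hL : 0 ≤ L) (hb : 0 ≤ b) (hτ : 0 ≤ τ)
    (hc : ContinuousOn g (Icc τ S))
    (hd : ∀ t ∈ Ioo τ S, ∃ d, HasDerivAt g d t ∧ b - L * g t ≤ d) (s : ℝ) (hs : s ∈ Icc τ S) :
    Real.exp (L * τ) * g τ + b * (s - τ) ≤ Real.exp (L * s) * g s := by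
  have hE : ∀ t ∈ Ioo τ S, ∃ D, HasDerivAt (fun t => Real.exp (L * t) * g t) D t ∧ b ≤ D := by
    intro t ht
    obtain ⟨d, hd1, hd2⟩ := hd t ht
    have h1 : HasDerivAt (fun t => Real.exp (L * t)) (Real.exp (L * t) * L) t := by
      simpa using ((hasDerivAt_id t).const_mul L).exp
    refine ⟨_, h1.mul hd1, ?_⟩
    have h2 : 1 ≤ Real.exp (L * t) := Real.one_le_exp (mul_nonneg hL (hτ.trans ht.1.le))
    nlinarith [mul_le_mul_of_nonneg_left hd2 (Real.exp_pos (L * t)).le]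
  have := (convex_Icc τ S).mul_sub_le_image_sub_of_le_deriv
    (f := fun t => Real.exp (L * t) * g t) (C := b)
    ((by fun_prop : Continuous fun t => Real.exp (L * t)).continuousOn.mul hc)
    (by
      rw [interior_Icc]; intro t ht
      obtain ⟨D, h, -⟩ := hE t ht
      exact h.differentiableAt.differentiableWithinAt)
    (by
      rw [interior_Icc]; intro t ht
      obtain ⟨D, h, h'⟩ := hE t ht
      rw [h.deriv]; exact h')
    τ ⟨le_refl _, hs.1.trans hs.2⟩ s hs hs.1
  linarith

/-- uniform positivity behind a spreading front. -/
theorem stmt17 {N : ℕ} (hN : 1 ≤ N) (T M₀ : ℝ) (hT : 0 < T) (hM₀ : 0 < M₀)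
    (κ : Euc N → ℝ) (hκ : KernelHyp κ)
    (f : ℝ → Euc N → ℝ → ℝ) (hf : SatH0 T M₀ f)
    (f₀ : ℝ → Euc N → ℝ → ℝ) (p : Fin N → ℝ) (h1 : SatH1 T M₀ p f f₀)
    (ξ : Euc N) (hξ : ‖ξ‖ = 1) (δ₀ : ℝ) (hδ₀ : 0 < δ₀) (nstar : ℕ)
    (ψ : ℝ → ℝ) (hψc : Continuous ψ) (hψm : Antitone ψ)
    (hψb : ∀ r, 0 ≤ ψ r ∧ ψ r ≤ δ₀)
    (hψinf : 0 < Filter.liminf ψ Filter.atBot)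
    (hψ0 : ∀ r ≥ (0:ℝ), ψ r = 0)
    (u : ℝ → Euc N → ℝ) (hu : IsSol κ f u (Set.Ici 0))
    (hu0 : ∀ x : Euc N, u 0 x = ψ (⟪x, ξ⟫ + (nstar : ℝ)))
    (K : ℕ) (hK : 1 ≤ K) (c' : ℝ) (hc' : 0 < c')
    (hi : ∀ t ∈ Set.Icc (0:ℝ) ((K : ℝ) * T), ∀ x : Euc N,
      ⟪x, ξ⟫ ≤ c' * (t + (K : ℝ) * T) - (nstar : ℝ) → δ₀ ≤ u (t + (K : ℝ) * T) x)
    (hii : ∀ t ∈ Set.Icc (0:ℝ) ((K : ℝ) * T), ∀ x : Euc N,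
      ψ (⟪x, ξ⟫ + (nstar : ℝ)) ≤ u (t + (K : ℝ) * T) x) :
    ∀ M > (0:ℝ), ∃ δt > (0:ℝ), ∀ t ≥ (K : ℝ) * T, ∀ x : Euc N,
      ⟪x, ξ⟫ ≤ M → δt ≤ u t x := by
  intro M hM
  obtain ⟨a1, a2, a3, a4⟩ := solBasic hu
  have hKpos : (0:ℝ) < K := by exact_mod_cast hK
  set P : ℝ := (K : ℝ) * T with hP
  have hPpos : 0 < P := mul_pos hKpos hT
  -- nonnegativity
  have hnn : ∀ t, 0 ≤ t → ∀ x, 0 ≤ u t x := by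
    refine compar hκ hf (u := fun _ _ => 0) (fun _ => continuousOn_const)
      (fun _ _ => continuous_const) (fun S => ⟨1, one_pos, by simp⟩) (fun x t _ => ?_)
      a1 a2 a3 a4 (fun x => ?_)
    · simp only [RHS]
      simpa using hasDerivAt_const t (0:ℝ)
    · rw [hu0]; exact (hψb _).1
  -- monotonicity in time steps
  have hmono : ∀ t, 0 ≤ t → ∀ x, u t x ≤ u (t + P) x := by
    refine compar hκ hf (v := fun t x => u (t + P) x) a1 a2 a3 a4 (fun x => ?_)
      (fun t ht => a2 _ (by linarith)) (fun S => ?_) (fun x t ht => ?_) (fun x => ?_)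
    · exact (a1 x).comp (f := fun s : ℝ => s + P) (by fun_prop)
        (fun s hs => by have : (0:ℝ) ≤ s := hs; show (0:ℝ) ≤ s + P; linarith)
    · obtain ⟨C, hC, h⟩ := a3 (S + P)
      exact ⟨C, hC, fun t ht x => h (t + P) ⟨by linarith [ht.1], by linarith [ht.2]⟩ x⟩
    · have h := (a4 x (t + P) (by linarith)).comp_add_const t P
      have hper : ∀ y, f (t + P) x y = f t x y := fun y =>
        (Function.Periodic.nat_mul (f := fun s => f s x y) (fun s => hf.1 s x y) K) t
      simp only [RHS, hper] at h ⊢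
      exact h
    · have := hii 0 ⟨le_refl _, hPpos.le⟩ x
      rw [hu0]; exact this
  have hmonon : ∀ n : ℕ, ∀ t, 0 ≤ t → ∀ x, u t x ≤ u (t + n * P) x := by
    intro n
    induction n with
    | zero => intro t _ x; simp
    | succ n ih =>
      intro t ht x
      have h1 := ih t ht x
      have h2 := hmono (t + n * P) (by positivity) x
      have e : t + ((n + 1 : ℕ) : ℝ) * P = t + n * P + P := by push_cast; ring
      rw [e]; exact h1.trans h2
  -- bounds on [0, 2P]
  obtain ⟨C, hC, hCu⟩ := a3 (2 * P)
  obtain ⟨L, hL, hLip⟩ := lipF hf C hC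
  have hder : ∀ t ∈ Ioo 0 (2 * P), ∀ x,
      (∫ y, κ (y - x) * u t y) - L * u t x ≤ RHS κ f u t x := by
    intro t ht x
    have h := hLip t x (u t x) 0 (hCu t (Ioo_subset_Icc_self ht) x) (by simpa using hC.le)
    have h' := (abs_le.1 h).1
    have h2 := hnn t ht.1.le x
    simp only [sub_zero, abs_of_nonneg h2] at h'
    simp only [RHS]
    linarith
  obtain ⟨η, hη, θ, hθ, hker⟩ := kerLow hκ ξ hξ
  -- initial data
  obtain ⟨m, hm, r₀, hr₀⟩ : ∃ m > 0, ∃ r₀ : ℝ, ∀ x : Euc N, ⟪x, ξ⟫ ≤ r₀ → m ≤ u 0 x := by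
    have hev := Filter.eventually_lt_of_lt_liminf (f := atBot) (u := ψ)
      (b := Filter.liminf ψ atBot / 2) (by linarith)
      (isBoundedUnder_of ⟨0, fun r => (hψb r).1⟩)
    obtain ⟨r, hr⟩ := eventually_atBot.1 hev
    refine ⟨Filter.liminf ψ atBot / 2, by linarith, r - nstar, fun x hx => ?_⟩
    rw [hu0]
    exact (hr _ (by linarith)).le
  have hstep : ∀ k : ℕ, ∀ τ, 0 < τ → ∃ a > 0, ∀ s ∈ Icc τ (2 * P), ∀ x : Euc N,
      ⟪x, ξ⟫ ≤ r₀ + k * η → a ≤ u s x := by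
    intro k
    induction k with
    | zero =>
      intro τ hτ
      refine ⟨m * Real.exp (-(L * (2 * P))), by positivity, fun s hs x hx => ?_⟩
      have hm0 := hr₀ x (by simpa using hx)
      have hs0 : s ∈ Icc 0 (2 * P) := ⟨hτ.le.trans hs.1, hs.2⟩
      have h := growth (fun t => u t x) (2 * P) L 0 0 hL le_rfl le_rfl
        ((a1 x).mono Icc_subset_Ici_self)
        (fun t ht => ⟨_, a4 x t ht.1, by
          have h1 := hder t ht x
          have h2 : 0 ≤ ∫ y, κ (y - x) * u t y :=
            integral_nonneg fun y => mul_nonneg (hκ.2.1 _) (hnn t ht.1.le y)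
          linarith⟩) s hs0
      simp only [mul_zero, Real.exp_zero, one_mul, zero_mul, add_zero] at h
      have h3 : Real.exp (L * s) ≤ Real.exp (L * (2 * P)) :=
        Real.exp_le_exp.2 (mul_le_mul_of_nonneg_left hs.2 hL)
      have h4 := mul_le_mul_of_nonneg_right h3 (hnn s hs0.1 x)
      rw [Real.exp_neg, ← div_eq_mul_inv, div_le_iff₀ (Real.exp_pos _)]
      linarith
    | succ k ih =>
      intro τ hτ
      obtain ⟨a, ha, hau⟩ := ih (τ / 2) (by linarith)
      refine ⟨(a * θ * (τ / 2)) * Real.exp (-(L * (2 * P))), by positivity, fun s hs x hx => ?_⟩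
      have hs0 : s ∈ Icc (τ / 2) (2 * P) := ⟨by linarith [hs.1], hs.2⟩
      have hspos : 0 ≤ s := by linarith [hs.1]
      have h := growth (fun t => u t x) (2 * P) L (a * θ) (τ / 2) hL (by positivity) (by linarith)
        ((a1 x).mono (fun t ht => by
          have := ht.1
          show (0:ℝ) ≤ t
          linarith))
        (fun t ht => by
          have ht0 : 0 < t := by linarith [ht.1]
          refine ⟨_, a4 x t ht0, ?_⟩
          have h1 := hder t ⟨ht0, ht.2⟩ x
          have h2 := hker (u t) a (r₀ + k * η) (a2 t ht0.le) (hnn t ht0.le) ha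
            (hau t (Ioo_subset_Icc_self ht)) x (by push_cast at hx; linarith)
          linarith) s hs0
      have h3 : Real.exp (L * s) ≤ Real.exp (L * (2 * P)) :=
        Real.exp_le_exp.2 (mul_le_mul_of_nonneg_left hs.2 hL)
      have h4 := mul_le_mul_of_nonneg_right h3 (hnn s hspos x)
      have h5 : 0 ≤ Real.exp (L * (τ / 2)) * u (τ / 2) x :=
        mul_nonneg (Real.exp_pos _).le (hnn _ (by linarith) x)
      have h6 : a * θ * (τ / 2) ≤ a * θ * (s - τ / 2) :=
        mul_le_mul_of_nonneg_left (by linarith [hs.1]) (by positivity)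
      rw [Real.exp_neg, ← div_eq_mul_inv, div_le_iff₀ (Real.exp_pos _)]
      linarith
  obtain ⟨k, hk⟩ := exists_nat_ge ((M - r₀) / η)
  rw [div_le_iff₀ hη] at hk
  obtain ⟨a, ha, hau⟩ := hstep k P hPpos
  refine ⟨a, ha, fun t ht x hx => ?_⟩
  have hq : 0 ≤ (t - P) / P := div_nonneg (by linarith) hPpos.le
  have hf1 := Nat.floor_le hq
  have hf2 := Nat.lt_floor_add_one ((t - P) / P)
  set n := ⌊(t - P) / P⌋₊
  rw [le_div_iff₀ hPpos] at hf1
  rw [div_lt_iff₀ hPpos] at hf2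
  have h1 := hau (t - n * P) ⟨by linarith, by linarith⟩ x (by linarith)
  have h2 := hmonon n (t - n * P) (by linarith) x
  rw [sub_add_cancel] at h2
  exact h1.trans h2

end
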